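/- Let μ₃ be the indicator function of the cubefree numbers. Then ∑_{n ≤ x} μ₃(⌊x/n⌋) = C · x + O(x^{1/3} (log x)²) as x → ∞, where C = ∑_{n=1}^∞ μ₃(n)/(n(n+1)). -/

import Mathlib

open Finset Filter Asymptotics

/-- `muk k n` is the indicator of the `k`-free numbers: `muk k n = 1` if no `k`-th power of
a prime divides `n`, and `muk k n = 0` otherwise. -/
noncomputable def muk (k n : ℕ) : ℝ :=
  letI := Classical.dec (∀ p : ℕ, p.Prime → ¬ p ^ k ∣ n)
  if ∀ p : ℕ, p.Prime → ¬ p ^ k ∣ n then 1 else 0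

/-- The additive character `t ↦ exp (2πit)` of the real line. -/
noncomputable def unitExp (t : ℝ) : ℂ := Complex.exp (Complex.I * ((2 * Real.pi * t : ℝ) : ℂ))

lemma norm_unitExp (t : ℝ) : ‖unitExp t‖ = 1 := by
  rw [unitExp, mul_comm, Complex.norm_exp_ofReal_mul_I]

lemma unitExp_add (s t : ℝ) : unitExp (s + t) = unitExp s * unitExp t := by
  rw [unitExp, unitExp, unitExp, ← Complex.exp_add]
  congr 1
  push_cast
  ring

lemma unitExp_re (t : ℝ) : (unitExp t).re = Real.cos (2 * Real.pi * t) := by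
  rw [unitExp, mul_comm, Complex.exp_ofReal_mul_I_re]

lemma norm_unitExp_sub_one_le (t : ℝ) : ‖unitExp t - 1‖ ≤ 2 * Real.pi * |t| := by
  have h := Real.norm_exp_I_mul_ofReal_sub_one_le (x := 2 * Real.pi * t)
  rwa [Real.norm_eq_abs, abs_mul, abs_of_pos Real.two_pi_pos] at h

lemma norm_unitExp_sub_one_le_two (t : ℝ) : ‖unitExp t - 1‖ ≤ 2 := by
  refine (norm_sub_le _ _).trans ?_
  rw [norm_unitExp, norm_one]
  norm_num

lemma norm_unitExp_sub_unitExp_le (s t : ℝ) :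
    ‖unitExp s - unitExp t‖ ≤ 2 * Real.pi * |s - t| := by
  have h : unitExp s - unitExp t = unitExp t * (unitExp (s - t) - 1) := by
    rw [mul_sub, ← unitExp_add, mul_one, add_sub_cancel]
  rw [h, norm_mul, norm_unitExp, one_mul]
  exact norm_unitExp_sub_one_le _

lemma abs_sub_round_le_norm_unitExp_sub_one (t : ℝ) : |t - round t| ≤ ‖unitExp t - 1‖ := by
  have hp := Real.pi_pos
  have hr := abs_sub_round t
  have hs := Real.mul_abs_le_abs_sin (x := Real.pi * (t - round t)) (by
    rw [abs_mul, abs_of_pos hp]; nlinarith)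
  have hsin : |Real.sin (Real.pi * (t - round t))| = |Real.sin (Real.pi * t)| := by
    rw [mul_sub, mul_comm Real.pi (round t : ℝ), Real.sin_sub_int_mul_pi, abs_mul]
    simp
  rw [unitExp, Complex.norm_exp_I_mul_ofReal_sub_one, Real.norm_eq_abs, abs_mul,
    show 2 * Real.pi * t / 2 = Real.pi * t by ring, ← hsin]
  rw [abs_mul, abs_of_pos hp, ← mul_assoc, div_mul_cancel₀ _ hp.ne'] at hs
  have := abs_nonneg (t - round t)
  rw [abs_of_pos (by norm_num : (0 : ℝ) < 2)]
  linarith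

lemma norm_sub_regularizedInv_le (z w : ℂ) {l : ℝ} (hl : 0 < l) :
    ‖starRingEnd ℂ z / ((‖z‖ ^ 2 + l : ℝ) : ℂ) - starRingEnd ℂ w / ((‖w‖ ^ 2 + l : ℝ) : ℂ)‖ ≤
      ‖z - w‖ * ((1 / (‖z‖ ^ 2 + l) + 1 / (‖w‖ ^ 2 + l)) / 2) := by
  set A := ‖z‖ ^ 2 + l with hA
  set B := ‖w‖ ^ 2 + l with hB
  have hA0 : 0 < A := by positivity
  have hB0 : 0 < B := by positivity
  have hz : z * starRingEnd ℂ z = ((‖z‖ ^ 2 : ℝ) : ℂ) := by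
    rw [Complex.mul_conj, Complex.normSq_eq_norm_sq]
  have hw : w * starRingEnd ℂ w = ((‖w‖ ^ 2 : ℝ) : ℂ) := by
    rw [Complex.mul_conj, Complex.normSq_eq_norm_sq]
  have hAc : (A : ℂ) ≠ 0 := by exact_mod_cast hA0.ne'
  have hBc : (B : ℂ) ≠ 0 := by exact_mod_cast hB0.ne'
  have key : starRingEnd ℂ z / (A : ℂ) - starRingEnd ℂ w / (B : ℂ) =
      (starRingEnd ℂ z * starRingEnd ℂ w * (w - z) + l * starRingEnd ℂ (z - w)) /
        ((A * B : ℝ) : ℂ) := by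
    rw [map_sub]
    push_cast
    rw [div_sub_div _ _ hAc hBc]
    congr 1
    rw [hA, hB]
    push_cast at hz hw ⊢
    rw [← hz, ← hw]
    ring
  rw [key, norm_div, Complex.norm_real, Real.norm_of_nonneg (by positivity)]
  have h1 : ‖starRingEnd ℂ z * starRingEnd ℂ w * (w - z) + l * starRingEnd ℂ (z - w)‖ ≤
      ‖z - w‖ * (‖z‖ * ‖w‖ + l) := by
    refine (norm_add_le _ _).trans (le_of_eq ?_)
    rw [norm_mul, norm_mul, norm_mul, RCLike.norm_conj, RCLike.norm_conj, RCLike.norm_conj,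
      Complex.norm_real, Real.norm_of_nonneg hl.le, norm_sub_rev w z]
    ring
  have h2 : ‖z‖ * ‖w‖ + l ≤ (A + B) / 2 := by
    rw [hA, hB]
    nlinarith [sq_nonneg (‖z‖ - ‖w‖)]
  rw [div_le_iff₀ (by positivity)]
  calc _ ≤ ‖z - w‖ * (‖z‖ * ‖w‖ + l) := h1
    _ ≤ ‖z - w‖ * ((A + B) / 2) := by gcongr
    _ = _ := by field_simp; ring

/-- The sum of `1 / (s² + l)` over `l`-spaced points is `O(l ^ (-3/2))`. -/
lemma sum_one_div_sq_add_le {s : ℕ → ℝ} {l : ℝ} {N : ℕ} (hl : 0 < l) (hl1 : l ≤ 1)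
    (hs : ∀ n < N, s n + l ≤ s (n + 1)) :
    ∑ n ∈ range N, 1 / (s n ^ 2 + l) ≤ 3 * Real.pi / (l * √l) := by
  have hr : 0 < √l := Real.sqrt_pos.2 hl
  have hrr : √l * √l = l := Real.mul_self_sqrt hl.le
  set F : ℝ → ℝ := fun t => Real.arctan (t / √l) / √l with hF
  have hder : ∀ t, HasDerivAt F (1 / (t ^ 2 + l)) t := by
    intro t
    have h := (((hasDerivAt_id t).div_const (√l)).arctan).div_const (√l)
    refine h.congr_deriv ?_
    have : 0 < t ^ 2 + l := by positivity
    simp only [id]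
    rw [div_pow, Real.sq_sqrt hl.le]
    field_simp
    rw [Real.sq_sqrt hl.le]
    ring
  have hmono : Monotone F := by
    apply monotone_of_deriv_nonneg (fun t => (hder t).differentiableAt)
    intro t
    rw [(hder t).deriv]
    positivity
  have hstep : ∀ n ∈ range N, 1 / (s n ^ 2 + l) ≤ 3 / l * (F (s (n + 1)) - F (s n)) := by
    intro n hn
    have h1 : s n < s n + l := by linarith
    obtain ⟨c, hc, hce⟩ := exists_hasDerivAt_eq_slope F (fun t => 1 / (t ^ 2 + l)) h1
      (fun t _ => (hder t).continuousAt.continuousWithinAt) (fun t _ => hder t)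
    have h2 : F (s n + l) ≤ F (s (n + 1)) := hmono (hs n (mem_range.1 hn))
    have h3 : c ^ 2 + l ≤ 3 * (s n ^ 2 + l) := by
      have h4 : (c - s n) ^ 2 ≤ l ^ 2 := by
        have := hc.1; have := hc.2
        nlinarith
      nlinarith [sq_nonneg (2 * s n - c)]
    have h5 : F (s n + l) - F (s n) = l / (c ^ 2 + l) := by
      rw [add_sub_cancel_left] at hce
      field_simp at hce ⊢
      linarith
    have h6 : 1 / (s n ^ 2 + l) ≤ 3 / (c ^ 2 + l) := by
      rw [div_le_div_iff₀ (by positivity) (by positivity)]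
      linarith
    calc _ ≤ 3 / (c ^ 2 + l) := h6
      _ = 3 / l * (F (s n + l) - F (s n)) := by rw [h5]; field_simp
      _ ≤ _ := by gcongr
  refine (sum_le_sum hstep).trans ?_
  rw [← mul_sum, sum_range_sub (fun n => F (s n))]
  have h7 : F (s N) - F (s 0) ≤ Real.pi / √l := by
    simp only [hF]
    rw [← sub_div]
    gcongr
    linarith [Real.arctan_lt_pi_div_two (s N / √l), Real.neg_pi_div_two_lt_arctan (s 0 / √l)]
  calc _ ≤ 3 / l * (Real.pi / √l) := by gcongr
    _ = _ := by field_simp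

lemma sum_one_div_norm_unitExp_sub_one_le {d : ℕ → ℝ} {l C : ℝ} {N : ℕ} (hl : 0 < l) (hl1 : l ≤ 1)
    (hlow : ∀ n ≤ N, d n + l ≤ d (n + 1)) (hup : ∀ n ≤ N, d (n + 1) ≤ d n + C * l) :
    ∑ n ∈ range (N + 1), 1 / (‖unitExp (d n) - 1‖ ^ 2 + l) ≤
      (C * l * N + 2) * (3 * Real.pi / (l * √l)) := by
  have hmono : ∀ n ≤ N, d 0 ≤ d n := by
    intro n
    induction n with
    | zero => intro _; exact le_rfl
    | succ n ih => intro hn; linarith [ih (by omega), hlow n (by omega)]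
  have hmono' : ∀ k ≤ N, d (N - k) ≤ d N := by
    intro k
    induction k with
    | zero => intro _; exact le_rfl
    | succ k ih =>
      intro hk
      have := hlow (N - (k + 1)) (by omega)
      rw [show N - (k + 1) + 1 = N - k by omega] at this
      linarith [ih (by omega)]
  have htot : ∀ n ≤ N, d n ≤ d 0 + C * l * n := by
    intro n
    induction n with
    | zero => intro _; simp
    | succ n ih => intro hn; push_cast; linarith [ih (by omega), hup n (by omega)]
  set S := Icc (round (d 0)) (round (d N)) with hS
  have hround : Monotone (round : ℝ → ℤ) := by
    intro a b hab
    rw [round_eq, round_eq]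
    exact Int.floor_mono (by linarith)
  have h1 : ∀ n ∈ range (N + 1), 1 / (‖unitExp (d n) - 1‖ ^ 2 + l) ≤
      ∑ m ∈ S, 1 / ((d n - m) ^ 2 + l) := by
    intro n hn
    have hnN : n ≤ N := by have := mem_range.1 hn; omega
    have hm : round (d n) ∈ S := by
      rw [hS, mem_Icc]
      refine ⟨hround (hmono n hnN), hround ?_⟩
      have := hmono' (N - n) (by omega)
      rwa [Nat.sub_sub_self hnN] at this
    refine le_trans ?_ (single_le_sum (f := fun m : ℤ => 1 / ((d n - m) ^ 2 + l))
      (fun m _ => by positivity) hm)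
    have := abs_sub_round_le_norm_unitExp_sub_one (d n)
    rw [← sq_abs (d n - _)]
    gcongr
  refine (sum_le_sum h1).trans ?_
  rw [sum_comm]
  have h2 : ∀ m ∈ S, ∑ n ∈ range (N + 1), 1 / ((d n - m) ^ 2 + l) ≤ 3 * Real.pi / (l * √l) := by
    intro m _
    refine sum_one_div_sq_add_le (s := fun n => d n - m) hl hl1 (fun n hn => ?_)
    have := hlow n (by omega)
    linarith
  refine (sum_le_card_nsmul _ _ _ h2).trans ?_
  rw [nsmul_eq_mul]
  gcongr
  have h3 : round (d 0) ≤ round (d N) := hround (hmono N le_rfl)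
  have h4 : ((#S : ℕ) : ℝ) = round (d N) + 1 - round (d 0) := by
    have : ((#S : ℕ) : ℤ) = round (d N) + 1 - round (d 0) := by
      rw [hS, Int.card_Icc]
      omega
    exact_mod_cast this
  rw [h4]
  have h5 := abs_le.1 (abs_sub_round (d 0))
  have h6 := abs_le.1 (abs_sub_round (d N))
  linarith [htot N le_rfl, h5.1, h5.2, h6.1, h6.2]

/-- **Van der Corput's second derivative test**, in terms of second differences. -/
lemma norm_sum_unitExp_le {g : ℕ → ℝ} {l C : ℝ} {N : ℕ} (hC : 1 ≤ C) (hl : 0 < l)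
    (hlow : ∀ n ≤ N, l ≤ g (n + 2) - 2 * g (n + 1) + g n)
    (hup : ∀ n ≤ N, g (n + 2) - 2 * g (n + 1) + g n ≤ C * l) :
    ‖∑ n ∈ range N, unitExp (g n)‖ ≤
      (1 + (2 * Real.pi * C + 1) * (3 * Real.pi) * (C + 2)) * (N * √l + 1 / √l) := by
  have hp := Real.pi_pos
  have hr : 0 < √l := Real.sqrt_pos.2 hl
  rcases le_or_gt l 1 with hl1 | hl1
  swap
  · have h1 : 1 ≤ √l := by rw [Real.one_le_sqrt]; exact hl1.le
    have h2 : ‖∑ n ∈ range N, unitExp (g n)‖ ≤ N := by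
      refine (norm_sum_le _ _).trans ?_
      simp [norm_unitExp]
    have h3 : (N : ℝ) ≤ N * √l + 1 / √l := by
      have : 0 ≤ 1 / √l := by positivity
      nlinarith [Nat.cast_nonneg (α := ℝ) N]
    refine h2.trans (h3.trans (le_mul_of_one_le_left (by positivity) ?_))
    rw [le_add_iff_nonneg_right]
    positivity
  set d : ℕ → ℝ := fun n => g (n + 1) - g n with hd
  set z : ℕ → ℂ := fun n => unitExp (d n) - 1 with hz
  set A : ℕ → ℝ := fun n => ‖z n‖ ^ 2 + l with hA
  set c : ℕ → ℂ := fun n => starRingEnd ℂ (z n) / (A n : ℂ) with hc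
  have hA0 : ∀ n, 0 < A n := fun n => by simp only [hA]; positivity
  have hT := sum_one_div_norm_unitExp_sub_one_le (d := d) (N := N) (C := C) hl hl1
    (fun n hn => by simp only [hd]; linarith [hlow n hn])
    (fun n hn => by simp only [hd]; linarith [hup n hn])
  change ∑ n ∈ range (N + 1), 1 / A n ≤ _ at hT
  set T := ∑ n ∈ range (N + 1), 1 / A n
  have hT1 : ∑ n ∈ range N, 1 / A n ≤ T := by
    refine sum_le_sum_of_subset_of_nonneg (range_subset_range.2 (by omega)) (fun n _ _ => ?_)
    have := hA0 n
    positivity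
  have hT2 : ∑ n ∈ range N, 1 / A (n + 1) ≤ T := by
    have h := sum_range_succ' (fun n => 1 / A n) N
    have := hA0 0
    have h0 : 0 ≤ 1 / A 0 := by positivity
    change T = _ at h
    linarith
  have hcn : ∀ n, ‖c n‖ ≤ 1 / (2 * √l) := by
    intro n
    simp only [hc]
    rw [norm_div, RCLike.norm_conj, Complex.norm_real, Real.norm_of_nonneg (hA0 n).le,
      div_le_div_iff₀ (hA0 n) (by positivity)]
    simp only [hA]
    nlinarith [sq_nonneg (‖z n‖ - √l), Real.sq_sqrt hl.le]
  have hE : ∀ n, unitExp (g n) = (unitExp (g (n + 1)) * c (n + 1) - unitExp (g n) * c n) -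
      unitExp (g (n + 1)) * (c (n + 1) - c n) + unitExp (g n) * ((l / A n : ℝ) : ℂ) := by
    intro n
    have h1 : unitExp (g (n + 1)) = unitExp (g n) * (z n + 1) := by
      simp only [hz, hd, sub_add_cancel]
      rw [← unitExp_add, add_sub_cancel]
    have h2 : z n * c n + ((l / A n : ℝ) : ℂ) = 1 := by
      simp only [hc]
      have hAc : (A n : ℂ) ≠ 0 := by exact_mod_cast (hA0 n).ne'
      push_cast
      rw [← mul_div_assoc, ← add_div, div_eq_one_iff_eq hAc, Complex.mul_conj,
        Complex.normSq_eq_norm_sq]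
      simp only [hA]
      push_cast
      ring
    rw [h1]
    linear_combination (-unitExp (g n)) * h2
  have hsum : ∑ n ∈ range N, unitExp (g n) = (unitExp (g N) * c N - unitExp (g 0) * c 0) -
      ∑ n ∈ range N, unitExp (g (n + 1)) * (c (n + 1) - c n) +
      ∑ n ∈ range N, unitExp (g n) * ((l / A n : ℝ) : ℂ) := by
    rw [← sum_range_sub (fun n => unitExp (g n) * c n), ← sum_sub_distrib, ← sum_add_distrib]
    exact sum_congr rfl fun n _ => hE n
  have hb1 : ‖unitExp (g N) * c N - unitExp (g 0) * c 0‖ ≤ 1 / √l := by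
    refine (norm_sub_le _ _).trans ?_
    rw [norm_mul, norm_mul, norm_unitExp, norm_unitExp, one_mul, one_mul]
    refine (add_le_add (hcn N) (hcn 0)).trans (le_of_eq ?_)
    field_simp
    norm_num
  have hb2 : ‖∑ n ∈ range N, unitExp (g (n + 1)) * (c (n + 1) - c n)‖ ≤
      2 * Real.pi * (C * l) * T := by
    have h1 : ∀ n ∈ range N, ‖unitExp (g (n + 1)) * (c (n + 1) - c n)‖ ≤
        2 * Real.pi * (C * l) * ((1 / A (n + 1) + 1 / A n) / 2) := by
      intro n hn
      have hnN : n ≤ N := (mem_range.1 hn).le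
      rw [norm_mul, norm_unitExp, one_mul]
      refine (norm_sub_regularizedInv_le (z (n + 1)) (z n) hl).trans ?_
      have h2 : ‖z (n + 1) - z n‖ ≤ 2 * Real.pi * (C * l) := by
        simp only [hz, sub_sub_sub_cancel_right]
        refine (norm_unitExp_sub_unitExp_le _ _).trans ?_
        gcongr
        simp only [hd]
        rw [abs_le]
        constructor <;> nlinarith [hlow n hnN, hup n hnN]
      have := hA0 n
      have := hA0 (n + 1)
      gcongr
    refine (norm_sum_le _ _).trans ((sum_le_sum h1).trans ?_)
    rw [← mul_sum, ← sum_div, sum_add_distrib]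
    gcongr
    linarith
  have hb3 : ‖∑ n ∈ range N, unitExp (g n) * ((l / A n : ℝ) : ℂ)‖ ≤ l * T := by
    have h1 : ∀ n ∈ range N, ‖unitExp (g n) * ((l / A n : ℝ) : ℂ)‖ ≤ l * (1 / A n) := by
      intro n _
      have := hA0 n
      rw [norm_mul, norm_unitExp, one_mul, Complex.norm_real, Real.norm_of_nonneg (by positivity),
        mul_one_div]
    refine (norm_sum_le _ _).trans ((sum_le_sum h1).trans ?_)
    rw [← mul_sum]
    gcongr
  have hlT : l * T ≤ 3 * Real.pi * (C + 2) * (N * √l + 1 / √l) := by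
    calc l * T ≤ l * ((C * l * N + 2) * (3 * Real.pi / (l * √l))) := by gcongr
      _ = 3 * Real.pi * (C * (N * (l / √l)) + 2 * (1 / √l)) := by field_simp
      _ = 3 * Real.pi * (C * (N * √l) + 2 * (1 / √l)) := by rw [Real.div_sqrt]
      _ ≤ 3 * Real.pi * ((C + 2) * (N * √l) + (C + 2) * (1 / √l)) := by
        gcongr <;> linarith
      _ = _ := by ring
  rw [hsum]
  refine (norm_add_le _ _).trans ?_
  refine (add_le_add (norm_sub_le _ _) le_rfl).trans ?_
  have h8 : 0 ≤ N * √l := by positivity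
  calc _ ≤ 1 / √l + 2 * Real.pi * (C * l) * T + l * T := by gcongr
    _ = 1 / √l + (2 * Real.pi * C + 1) * (l * T) := by ring
    _ ≤ (N * √l + 1 / √l) + (2 * Real.pi * C + 1) *
        (3 * Real.pi * (C + 2) * (N * √l + 1 / √l)) := by gcongr; linarith
    _ = _ := by ring

/-- The sawtooth function `ψ(u) = {u} - 1/2`. -/
noncomputable def sawtooth (u : ℝ) : ℝ := Int.fract u - 1 / 2

/-- The periodized second Bernoulli polynomial. -/
noncomputable def periodicBernoulliTwo (u : ℝ) : ℝ := Int.fract u ^ 2 - Int.fract u + 1 / 6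

lemma abs_sawtooth_le (u : ℝ) : |sawtooth u| ≤ 1 / 2 := by
  have h0 := Int.fract_nonneg u
  have h1 := Int.fract_lt_one u
  rw [sawtooth, abs_le]
  constructor <;> linarith

lemma fract_add_cases (u : ℝ) {t : ℝ} (ht : 0 ≤ t) (ht1 : t ≤ 1) :
    (Int.fract (u + t) = Int.fract u + t) ∨
      (Int.fract (u + t) = Int.fract u + t - 1 ∧ 1 ≤ Int.fract u + t) := by
  have h0 := Int.fract_nonneg u
  have h1 := Int.fract_lt_one u
  have hu := Int.floor_add_fract u
  rcases lt_or_ge (Int.fract u + t) 1 with h | h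
  · left
    rw [Int.fract_eq_iff]
    exact ⟨by linarith, h, ⌊u⌋, by linarith⟩
  · right
    refine ⟨?_, h⟩
    rw [Int.fract_eq_iff]
    exact ⟨by linarith, by linarith, ⌊u⌋ + 1, by push_cast; linarith⟩

lemma periodicBernoulliTwo_add_sub_le (u : ℝ) {t : ℝ} (ht : 0 ≤ t) (ht1 : t ≤ 1) :
    periodicBernoulliTwo (u + t) - periodicBernoulliTwo u ≤ 2 * t * sawtooth u + t ^ 2 := by
  have h0 := Int.fract_nonneg u
  have h1 := Int.fract_lt_one u
  simp only [periodicBernoulliTwo, sawtooth]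
  rcases fract_add_cases u ht ht1 with h | ⟨h, h2⟩ <;> rw [h] <;> nlinarith

lemma le_periodicBernoulliTwo_sub_sub (u : ℝ) {t : ℝ} (ht : 0 ≤ t) (ht1 : t ≤ 1) :
    2 * t * sawtooth u - t ^ 2 ≤ periodicBernoulliTwo u - periodicBernoulliTwo (u - t) := by
  have h0 := Int.fract_nonneg (u - t)
  have h1 := Int.fract_lt_one (u - t)
  simp only [periodicBernoulliTwo, sawtooth]
  have hc := fract_add_cases (u - t) ht ht1
  rw [sub_add_cancel] at hc
  rcases hc with h | ⟨h, h2⟩ <;> rw [h] <;> nlinarith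

lemma hasSum_periodicBernoulliTwo (u : ℝ) :
    HasSum (fun n : ℕ => 1 / (n : ℝ) ^ 2 * Real.cos (2 * Real.pi * (n * u)))
      (Real.pi ^ 2 * periodicBernoulliTwo u) := by
  have h := hasSum_one_div_nat_pow_mul_cos (k := 1) one_ne_zero
    (x := Int.fract u) ⟨Int.fract_nonneg u, (Int.fract_lt_one u).le⟩
  convert h using 1
  · ext n
    rw [mul_one]
    congr 1
    rw [show 2 * Real.pi * n * Int.fract u =
      2 * Real.pi * (n * u) - ((n * ⌊u⌋ : ℤ) : ℝ) * (2 * Real.pi) by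
        rw [Int.fract]; push_cast; ring, Real.cos_sub_int_mul_two_pi]
  · rw [periodicBernoulliTwo]
    simp [Polynomial.bernoulli, Finset.sum_range_succ, Polynomial.eval_add, bernoulli_two,
      bernoulli_one, Polynomial.map_monomial]
    ring

lemma abs_sum_cos_sub_cos_le {N : ℕ} (u : ℕ → ℝ) (t : ℝ) (h : ℕ) :
    |∑ n ∈ range N, (Real.cos (2 * Real.pi * (h * (u n + t))) -
        Real.cos (2 * Real.pi * (h * u n)))| ≤
      4 * Real.pi * (h * |t|) / (1 + h * |t|) * ‖∑ n ∈ range N, unitExp (h * u n)‖ := by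
  have h1 : ∑ n ∈ range N, (Real.cos (2 * Real.pi * (h * (u n + t))) -
        Real.cos (2 * Real.pi * (h * u n))) =
      ((unitExp (h * t) - 1) * ∑ n ∈ range N, unitExp (h * u n)).re := by
    rw [mul_sum, Complex.re_sum]
    refine sum_congr rfl fun n _ => ?_
    rw [← unitExp_re, ← unitExp_re, ← Complex.sub_re, mul_add, unitExp_add]
    congr 1
    ring
  rw [h1]
  refine (Complex.abs_re_le_norm _).trans ?_
  rw [norm_mul]
  gcongr
  have hp := Real.pi_gt_three
  have h2 := norm_unitExp_sub_one_le (h * t)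
  have h3 := norm_unitExp_sub_one_le_two (h * t)
  rw [abs_mul, Nat.abs_cast] at h2
  set s := (h : ℝ) * |t| with hs
  have hs0 : 0 ≤ s := by positivity
  rw [le_div_iff₀ (by positivity)]
  nlinarith [norm_nonneg (unitExp (h * t) - 1)]

lemma sum_one_div_sqrt_mul_le {δ : ℝ} (hδ : 0 < δ) (H : ℕ) :
    ∑ h ∈ range H, 1 / (√((h : ℝ) + 1) * (1 + ((h : ℝ) + 1) * δ)) ≤ Real.pi / √δ := by
  have hr : 0 < √δ := Real.sqrt_pos.2 hδ
  set F : ℝ → ℝ := fun t => 2 / √δ * Real.arctan (√δ * √t) with hF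
  have hder : ∀ t, 0 < t → HasDerivAt F (1 / (√t * (1 + t * δ))) t := by
    intro t ht
    have hst : 0 < √t := Real.sqrt_pos.2 ht
    have h := (((Real.hasDerivAt_sqrt ht.ne').const_mul (√δ)).arctan).const_mul (2 / √δ)
    refine h.congr_deriv ?_
    rw [mul_pow, Real.sq_sqrt hδ.le, Real.sq_sqrt ht.le]
    field_simp
  have hcont : Continuous F := by
    simp only [hF]
    fun_prop
  have hstep : ∀ h ∈ range H, 1 / (√((h : ℝ) + 1) * (1 + ((h : ℝ) + 1) * δ)) ≤
      F ((h + 1 : ℕ) : ℝ) - F (h : ℝ) := by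
    intro h _
    have h0 : (0 : ℝ) ≤ h := Nat.cast_nonneg h
    obtain ⟨c, hc, hce⟩ := exists_hasDerivAt_eq_slope F (fun t => 1 / (√t * (1 + t * δ)))
      (show (h : ℝ) < (h : ℝ) + 1 by linarith) hcont.continuousOn
      (fun t ht => hder t (h0.trans_lt ht.1))
    have hc0 : 0 < c := h0.trans_lt hc.1
    have hsc : 0 < √c := Real.sqrt_pos.2 hc0
    rw [add_sub_cancel_left, div_one] at hce
    push_cast
    rw [← hce]
    have := hc.2.le
    gcongr
  refine (sum_le_sum hstep).trans ?_
  rw [sum_range_sub (fun h : ℕ => F (h : ℝ))]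
  simp only [hF, Nat.cast_zero, Real.sqrt_zero, mul_zero, Real.arctan_zero, sub_zero]
  calc _ ≤ 2 / √δ * (Real.pi / 2) := by
        gcongr
        exact (Real.arctan_lt_pi_div_two _).le
    _ = _ := by ring

lemma sum_one_div_mul_sqrt_le (H : ℕ) :
    ∑ h ∈ range H, 1 / (((h : ℝ) + 1) * √((h : ℝ) + 1)) ≤ 4 := by
  suffices h : ∀ H : ℕ, ∑ h ∈ range H, 1 / (((h : ℝ) + 1) * √((h : ℝ) + 1)) ≤
      4 - 4 / √((H : ℝ) + 1) by
    refine (h H).trans ?_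
    have : 0 ≤ 4 / √((H : ℝ) + 1) := by positivity
    linarith
  intro H
  induction H with
  | zero => norm_num
  | succ H ih =>
    rw [sum_range_succ]
    push_cast
    set a := √((H : ℝ) + 1) with ha
    set b := √((H : ℝ) + 1 + 1) with hb
    have ha2 : a ^ 2 = (H : ℝ) + 1 := Real.sq_sqrt (by positivity)
    have hb2 : b ^ 2 = (H : ℝ) + 1 + 1 := Real.sq_sqrt (by positivity)
    have ha0 : 0 < a := Real.sqrt_pos.2 (by positivity)
    have hb0 : 0 < b := Real.sqrt_pos.2 (by positivity)
    have hab : a ≤ b := Real.sqrt_le_sqrt (by linarith)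
    have hba : b ≤ 3 / 2 * a := by nlinarith [Nat.cast_nonneg (α := ℝ) H]
    have key : 1 / (a ^ 2 * a) ≤ 4 / a - 4 / b := by
      have h1 : 4 / a - 4 / b = 4 / (a * b * (a + b)) := by
        field_simp
        linear_combination hb2 - ha2
      rw [h1, div_le_div_iff₀ (by positivity) (by positivity), one_mul]
      have h2 : a * b * (a + b) ≤ a * (3 / 2 * a) * (a + 3 / 2 * a) := by gcongr
      have h3 : 0 < a ^ 2 * a := by positivity
      nlinarith
    rw [← ha2]
    linarith

lemma abs_sum_periodicBernoulliTwo_sub_le {N : ℕ} {u : ℕ → ℝ} {P Q t : ℝ} (ht : t ≠ 0)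
    (hP : 0 ≤ P) (hQ : 0 ≤ Q)
    (hS : ∀ h : ℕ, 1 ≤ h → ‖∑ n ∈ range N, unitExp (h * u n)‖ ≤ P * √h + Q / √h) :
    |∑ n ∈ range N, (periodicBernoulliTwo (u n + t) - periodicBernoulliTwo (u n))| ≤
      4 * |t| * (P / √|t| + 2 * Q) := by
  have hp := Real.pi_gt_three
  have ht0 : 0 < |t| := abs_pos.2 ht
  have h1 : HasSum (fun h : ℕ => ∑ n ∈ range N,
      (1 / (h : ℝ) ^ 2 * Real.cos (2 * Real.pi * (h * (u n + t))) -
        1 / (h : ℝ) ^ 2 * Real.cos (2 * Real.pi * (h * u n))))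
      (∑ n ∈ range N, (Real.pi ^ 2 * periodicBernoulliTwo (u n + t) -
        Real.pi ^ 2 * periodicBernoulliTwo (u n))) :=
    hasSum_sum fun n _ => (hasSum_periodicBernoulliTwo _).sub (hasSum_periodicBernoulliTwo _)
  have h2 : ∀ H : ℕ, ‖∑ h ∈ range H, ∑ n ∈ range N,
      (1 / (h : ℝ) ^ 2 * Real.cos (2 * Real.pi * (h * (u n + t))) -
        1 / (h : ℝ) ^ 2 * Real.cos (2 * Real.pi * (h * u n)))‖ ≤
        4 * Real.pi * |t| * (P * (Real.pi / √|t|) + Q * 4) := by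
    intro H
    have h3 : ∀ h : ℕ, ‖∑ n ∈ range N,
        (1 / ((h + 1 : ℕ) : ℝ) ^ 2 * Real.cos (2 * Real.pi * ((h + 1 : ℕ) * (u n + t))) -
          1 / ((h + 1 : ℕ) : ℝ) ^ 2 * Real.cos (2 * Real.pi * ((h + 1 : ℕ) * u n)))‖ ≤
        4 * Real.pi * |t| * (P * (1 / (√((h : ℝ) + 1) * (1 + ((h : ℝ) + 1) * |t|))) +
          Q * (1 / (((h : ℝ) + 1) * √((h : ℝ) + 1)))) := by
      intro h
      simp only [← mul_sub]
      rw [← mul_sum, Real.norm_eq_abs, abs_mul, abs_of_nonneg (by positivity)]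
      have h4 := (abs_sum_cos_sub_cos_le (N := N) u t (h + 1)).trans
        (mul_le_mul_of_nonneg_left (hS (h + 1) (by omega)) (by positivity))
      refine (mul_le_mul_of_nonneg_left h4 (by positivity)).trans ?_
      push_cast
      set a : ℝ := (h : ℝ) + 1 with ha
      have ha0 : 0 < a := by positivity
      have hs0 : 0 < √a := Real.sqrt_pos.2 ha0
      have haa : √a * √a = a := Real.mul_self_sqrt ha0.le
      calc _ = 4 * Real.pi * |t| * (P * (√a / (a * (1 + a * |t|))) +
            Q * (1 / (a * √a * (1 + a * |t|)))) := by field_simp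
        _ ≤ _ := by
          have h5 : √a / (a * (1 + a * |t|)) = 1 / (√a * (1 + a * |t|)) := by
            rw [div_eq_div_iff (by positivity) (by positivity)]
            linear_combination (1 + a * |t|) * haa
          have h6 : 1 / (a * √a * (1 + a * |t|)) ≤ 1 / (a * √a) := by
            refine one_div_le_one_div_of_le (by positivity)
              (le_mul_of_one_le_right (by positivity) ?_)
            rw [le_add_iff_nonneg_right]
            positivity
          rw [h5]
          exact mul_le_mul_of_nonneg_left (add_le_add le_rfl (mul_le_mul_of_nonneg_left h6 hQ))
            (by positivity)
    rcases H with _ | H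
    · rw [sum_range_zero, norm_zero]
      positivity
    · rw [sum_range_succ']
      simp only [Nat.cast_zero, ne_eq, OfNat.ofNat_ne_zero, not_false_eq_true, zero_pow, div_zero,
        zero_mul, sub_zero, sum_const_zero, add_zero]
      refine (norm_sum_le _ _).trans ((sum_le_sum fun h _ => h3 h).trans ?_)
      rw [← mul_sum, sum_add_distrib, ← mul_sum, ← mul_sum]
      gcongr
      · exact sum_one_div_sqrt_mul_le ht0 H
      · exact sum_one_div_mul_sqrt_le H
  have h7 := le_of_tendsto h1.tendsto_sum_nat.norm (Eventually.of_forall h2)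
  simp only [← mul_sub] at h7
  rw [← mul_sum, Real.norm_eq_abs, abs_mul, abs_of_pos (by positivity)] at h7
  have h8 : 4 * Real.pi * |t| * (P * (Real.pi / √|t|) + Q * 4) ≤
      Real.pi ^ 2 * (4 * |t| * (P / √|t| + 2 * Q)) := by
    have : 4 * Real.pi * |t| * (P * (Real.pi / √|t|) + Q * 4) ≤
        4 * Real.pi * |t| * (P * (Real.pi / √|t|) + Q * (2 * Real.pi)) := by
      gcongr
      linarith
    refine this.trans (le_of_eq ?_)
    ring
  exact le_of_mul_le_mul_left (h7.trans h8) (by positivity)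

/-- A sawtooth sum is controlled by the exponential sums of all its harmonics. -/
lemma abs_sum_sawtooth_le {N : ℕ} {u : ℕ → ℝ} {P Q δ : ℝ} (hδ : 0 < δ) (hδ1 : δ ≤ 1)
    (hP : 0 ≤ P) (hQ : 0 ≤ Q)
    (hS : ∀ h : ℕ, 1 ≤ h → ‖∑ n ∈ range N, unitExp (h * u n)‖ ≤ P * √h + Q / √h) :
    |∑ n ∈ range N, sawtooth (u n)| ≤ N * δ + 2 * P / √δ + 4 * Q := by
  have h1 := abs_le.1 (abs_sum_periodicBernoulliTwo_sub_le (t := δ) hδ.ne' hP hQ hS)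
  have h2 := abs_le.1 (abs_sum_periodicBernoulliTwo_sub_le (t := -δ) (by linarith) hP hQ hS)
  rw [abs_neg] at h2
  rw [abs_of_pos hδ] at h1 h2
  have h3 := sum_le_sum fun n (_ : n ∈ range N) =>
    periodicBernoulliTwo_add_sub_le (u n) hδ.le hδ1
  have h4 := sum_le_sum fun n (_ : n ∈ range N) =>
    le_periodicBernoulliTwo_sub_sub (u n) hδ.le hδ1
  have h5 : ∑ n ∈ range N, (periodicBernoulliTwo (u n) - periodicBernoulliTwo (u n - δ)) =
      -∑ n ∈ range N, (periodicBernoulliTwo (u n + -δ) - periodicBernoulliTwo (u n)) := by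
    rw [← sum_neg_distrib]
    exact sum_congr rfl fun n _ => by rw [neg_sub, sub_eq_add_neg (u n) δ]
  rw [h5] at h4
  rw [sum_add_distrib, ← mul_sum, sum_const, card_range, nsmul_eq_mul] at h3
  rw [sum_sub_distrib, ← mul_sum, sum_const, card_range, nsmul_eq_mul] at h4
  have h6 : 2 * P / √δ = 2 * (P / √δ) := by ring
  rw [h6, abs_le]
  have h7 : (0 : ℝ) ≤ N * δ := by positivity
  constructor
  · refine le_of_mul_le_mul_left ?_ (show (0 : ℝ) < 2 * δ by linarith)
    nlinarith [h1.1]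
  · refine le_of_mul_le_mul_left ?_ (show (0 : ℝ) < 2 * δ by linarith)
    nlinarith [h2.1]

lemma sub_mul_add_one_div_eq {t : ℝ} (ht : 0 < t) :
    1 / (t + 2) - 2 * (1 / (t + 1)) + 1 / t = 2 / (t * (t + 1) * (t + 2)) := by
  field_simp
  ring

lemma exists_abs_sum_sawtooth_block_le :
    ∃ A : ℝ, 0 ≤ A ∧ ∀ (y a b : ℝ) (m N : ℕ), 1 ≤ y → 0 ≤ a → a ≤ 1 → 1 ≤ m → N ≤ m →
      (m : ℝ) ≤ 2 * √y →
      |∑ n ∈ range N, sawtooth (y / (m + n + a) + b)| ≤ A * y ^ (1 / 3 : ℝ) := by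
  set K : ℝ := 1 + (2 * Real.pi * 60 + 1) * (3 * Real.pi) * (60 + 2) with hK
  have hp := Real.pi_pos
  have hK0 : 0 < K := by positivity
  refine ⟨1 + 2 * K + 64 * K, by positivity, ?_⟩
  intro y a b m N hy ha ha1 hm hNm hmy
  have hy0 : 0 < y := by linarith
  have hm1 : (1 : ℝ) ≤ m := by exact_mod_cast hm
  have hNm' : (N : ℝ) ≤ m := by exact_mod_cast hNm
  set w := y ^ (1 / 3 : ℝ) with hw
  have hw1 : 1 ≤ w := Real.one_le_rpow hy (by norm_num)
  have hw3 : w ^ 3 = y := by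
    rw [hw, ← Real.rpow_natCast, ← Real.rpow_mul hy0.le]
    norm_num
  set l : ℝ := y / (30 * m ^ 3) with hl
  have hl0 : 0 < l := by positivity
  set δ := l ^ (1 / 3 : ℝ) with hδ
  have hδ0 : 0 < δ := Real.rpow_pos_of_pos hl0 _
  have hδ3 : δ ^ 3 = l := by
    rw [hδ, ← Real.rpow_natCast, ← Real.rpow_mul hl0.le]
    norm_num
  have hmδ : m * δ ≤ w := by
    refine le_of_pow_le_pow_left₀ three_ne_zero (by positivity) ?_
    rw [mul_pow, hδ3, hw3, hl]
    have : (m : ℝ) ^ 3 * (y / (30 * m ^ 3)) = y / 30 := by field_simp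
    rw [this]
    linarith
  have hNδ : N * δ ≤ w := le_trans (by gcongr) hmδ
  rcases le_or_gt δ 1 with hδ1 | hδ1
  swap
  · have h1 : |∑ n ∈ range N, sawtooth (y / (m + n + a) + b)| ≤ N * (1 / 2) := by
      refine (abs_sum_le_sum_abs _ _).trans ((sum_le_sum fun n _ => abs_sawtooth_le _).trans ?_)
      simp
    have h2 : (N : ℝ) * (1 / 2) ≤ w := by nlinarith [Nat.cast_nonneg (α := ℝ) N]
    refine h1.trans (h2.trans (le_mul_of_one_le_left (by positivity) ?_))
    linarith
  have hsl : √l = δ * √δ := by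
    rw [← hδ3, show δ ^ 3 = δ ^ 2 * δ by ring, Real.sqrt_mul (by positivity),
      Real.sqrt_sq hδ0.le]
  have hsl0 : 0 < √l := Real.sqrt_pos.2 hl0
  have hinv : 1 / √l ≤ 16 * w := by
    rw [div_le_iff₀ hsl0]
    refine le_of_pow_le_pow_left₀ two_ne_zero (by positivity) ?_
    rw [one_pow, mul_pow, Real.sq_sqrt hl0.le, hl, ← mul_div_assoc, le_div_iff₀ (by positivity)]
    have hsy : √y ≤ w ^ 2 := by
      rw [Real.sqrt_le_iff]
      refine ⟨by positivity, ?_⟩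
      rw [← hw3, ← pow_mul]
      exact pow_le_pow_right₀ hw1 (by norm_num)
    have hm3 : (m : ℝ) ^ 3 ≤ 8 * (y * w ^ 2) := by
      calc (m : ℝ) ^ 3 ≤ (2 * √y) ^ 3 := by gcongr
        _ = 8 * (√y ^ 2 * √y) := by ring
        _ = 8 * (y * √y) := by rw [Real.sq_sqrt hy0.le]
        _ ≤ _ := by gcongr
    have : 0 ≤ y * w ^ 2 := by positivity
    nlinarith
  have hS : ∀ h : ℕ, 1 ≤ h → ‖∑ n ∈ range N, unitExp (h * (y / (m + n + a) + b))‖ ≤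
      (K * N * √l) * √h + (K / √l) / √h := by
    intro h hh
    have hh0 : (0 : ℝ) < h := by exact_mod_cast hh
    have hdiff : ∀ n : ℕ, h * (y / (m + (n + 2 : ℕ) + a) + b) -
        2 * (h * (y / (m + (n + 1 : ℕ) + a) + b)) + h * (y / (m + n + a) + b) =
        h * y * (2 / ((m + n + a) * (m + n + a + 1) * (m + n + a + 2))) := by
      intro n
      rw [← sub_mul_add_one_div_eq (by positivity)]
      push_cast
      rw [show (m : ℝ) + (n + 2) + a = m + n + a + 2 by ring,
        show (m : ℝ) + (n + 1) + a = m + n + a + 1 by ring]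
      ring
    have hv := norm_sum_unitExp_le (g := fun n : ℕ => h * (y / (m + n + a) + b)) (l := h * l)
      (C := 60) (N := N) (by norm_num) (by positivity)
      (fun n hn => by
        rw [hdiff, mul_assoc]
        gcongr
        rw [hl, div_eq_mul_inv]
        gcongr
        rw [inv_eq_one_div, div_le_div_iff₀ (by positivity) (by positivity), one_mul]
        have hn' : (n : ℝ) ≤ m := by exact_mod_cast hn.trans hNm
        calc ((m : ℝ) + n + a) * (m + n + a + 1) * (m + n + a + 2)
            ≤ (3 * m) * (4 * m) * (5 * m) := by gcongr <;> linarith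
          _ = _ := by ring)
      (fun n hn => by
        rw [hdiff, hl]
        have h1 : 60 * (h * (y / (30 * (m : ℝ) ^ 3))) = h * y * (2 / (m * m * m)) := by
          field_simp
          norm_num
        rw [h1]
        have hn0 := Nat.cast_nonneg (α := ℝ) n
        gcongr <;> linarith)
    refine hv.trans (le_of_eq ?_)
    rw [Real.sqrt_mul hh0.le, ← hK]
    field_simp
  have hmain := abs_sum_sawtooth_le hδ0 hδ1 (by positivity) (by positivity) hS
  refine hmain.trans ?_
  have h3 : 2 * (K * N * √l) / √δ = 2 * K * (N * δ) := by
    rw [hsl]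
    field_simp
  rw [h3, div_eq_mul_one_div K]
  calc _ ≤ w + 2 * K * w + 4 * (K * (16 * w)) := by gcongr
    _ = _ := by ring

/-- Sawtooth sums over hyperbola arguments `y / (k + a) + b` with `k ≪ √y`. -/
lemma exists_abs_sum_sawtooth_le :
    ∃ A : ℝ, 0 ≤ A ∧ ∀ (y a b : ℝ) (K : ℕ), 1 ≤ y → 0 ≤ a → a ≤ 1 → (K : ℝ) ≤ 2 * √y →
      |∑ k ∈ range K, sawtooth (y / ((k : ℝ) + 1 + a) + b)| ≤
        A * y ^ (1 / 3 : ℝ) * (1 + Real.log y) := by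
  obtain ⟨A, hA, hblock⟩ := exists_abs_sum_sawtooth_block_le
  refine ⟨2 * A, by positivity, ?_⟩
  intro y a b K hy ha ha1 hK
  have hy0 : 0 < y := by linarith
  have hw0 : 0 ≤ y ^ (1 / 3 : ℝ) := by positivity
  have hdyadic : ∀ K : ℕ, (K : ℝ) ≤ 2 * √y →
      |∑ k ∈ range K, sawtooth (y / ((k : ℝ) + 1 + a) + b)| ≤
        A * y ^ (1 / 3 : ℝ) * (Nat.log 2 K + 1) := by
    intro K
    induction K using Nat.strong_induction_on with
    | _ K ih =>
    intro hK
    have hsy : 1 ≤ √y := by rwa [Real.one_le_sqrt]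
    have hb : ∀ m N : ℕ, N ≤ m + 1 → (m + 1 : ℕ) ≤ 2 * √y →
        |∑ n ∈ range N, sawtooth (y / (((m + n : ℕ) : ℝ) + 1 + a) + b)| ≤
          A * y ^ (1 / 3 : ℝ) := by
      intro m N hN hm
      have := hblock y a b (m + 1) N hy ha ha1 (by omega) hN hm
      convert this using 6
      push_cast
      ring
    rcases lt_or_ge K 2 with h2 | h2
    · have h0 : Nat.log 2 K = 0 := Nat.log_of_lt h2
      rw [h0]
      have := hb 0 K (by omega) (by push_cast; linarith)
      simpa using this
    · obtain ⟨M, hM⟩ : ∃ M, M = K / 2 := ⟨_, rfl⟩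
      have hsplit : K = M + (K - M) := by omega
      have h1 := ih M (by omega) (le_trans (by exact_mod_cast (by omega : M ≤ K)) hK)
      have h3 := hb M (K - M) (by omega) (le_trans (by exact_mod_cast (by omega : M + 1 ≤ K)) hK)
      have hlog : Nat.log 2 K = Nat.log 2 M + 1 := by
        rw [hM, Nat.log_of_one_lt_of_le (by norm_num) h2]
      rw [hsplit, sum_range_add, ← hsplit, hlog]
      refine (abs_add_le _ _).trans ((add_le_add h1 h3).trans (le_of_eq ?_))
      push_cast
      ring
  refine (hdyadic K hK).trans ?_
  have hlog0 : 0 ≤ Real.log y := Real.log_nonneg hy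
  have hlogK : (Nat.log 2 K : ℝ) ≤ 1 + 2 * Real.log y := by
    rcases Nat.eq_zero_or_pos K with h0 | h0
    · rw [h0]
      simp
      linarith
    have hK0 : (0 : ℝ) < K := by exact_mod_cast h0
    have h1 := Real.natLog_le_logb K 2
    have h2 : Real.log K ≤ Real.log 2 + Real.log y := by
      rw [← Real.log_mul (by norm_num) hy0.ne']
      refine Real.log_le_log hK0 (hK.trans ?_)
      have : √y ≤ y := by
        rw [Real.sqrt_le_iff]
        constructor <;> nlinarith
      linarith
    have h3 := Real.log_two_gt_d9
    refine h1.trans ?_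
    rw [Real.logb]
    push_cast
    rw [div_le_iff₀ (by linarith)]
    nlinarith
  calc _ ≤ A * y ^ (1 / 3 : ℝ) * (1 + 2 * Real.log y + 1) := by gcongr
    _ = _ := by ring

lemma natCast_div_eq_sub_sawtooth (m n : ℕ) :
    ((m / n : ℕ) : ℝ) = m / n - sawtooth (m / n) - 1 / 2 := by
  have h : ((m / n : ℕ) : ℝ) = (⌊(m : ℝ) / n⌋ : ℝ) := by
    rw [← Nat.floor_div_eq_div (K := ℝ), natCast_floor_eq_intCast_floor (by positivity)]
  rw [h, sawtooth, Int.fract]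
  ring

lemma ite_dvd_div_eq_sawtooth {M n q : ℕ} (hn : 0 < n) (hq : 0 < q) :
    (if q ∣ M / n then 1 else 0 : ℝ) =
      1 / q + sawtooth ((M : ℝ) / q / n - 1 / q) - sawtooth ((M : ℝ) / q / n) := by
  have hn' : (0 : ℝ) < n := by exact_mod_cast hn
  have hq' : (0 : ℝ) < q := by exact_mod_cast hq
  obtain ⟨t, ht⟩ : ∃ t, t = M / n := ⟨_, rfl⟩
  have ht0 : (t : ℝ) * n ≤ M := by
    rw [ht]
    exact_mod_cast Nat.div_mul_le_self M n
  have ht1 : (M : ℝ) < (t + 1) * n := by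
    rw [ht]
    exact_mod_cast (Nat.div_lt_iff_lt_mul hn).1 (Nat.lt_add_one (M / n))
  obtain ⟨s, hs⟩ : ∃ s, s = t / q := ⟨_, rfl⟩
  obtain ⟨r, hr⟩ : ∃ r, r = t % q := ⟨_, rfl⟩
  have htsr : t = q * s + r := by rw [hs, hr, Nat.div_add_mod]
  have hrq : r + 1 ≤ q := by rw [hr]; exact Nat.mod_lt t hq
  have htsr' : (t : ℝ) = q * s + r := by exact_mod_cast htsr
  have hrq' : (r : ℝ) + 1 ≤ q := by exact_mod_cast hrq
  have hr0 := Nat.cast_nonneg (α := ℝ) r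
  have hv0 : (t : ℝ) ≤ M / n := by rwa [le_div_iff₀ hn']
  have hv1 : (M : ℝ) / n < t + 1 := by rwa [div_lt_iff₀ hn']
  have hu : (M : ℝ) / q / n = (M / n) / q := by field_simp
  rw [hu]
  set v := (M : ℝ) / n
  have hf : ⌊v / q⌋ = (s : ℤ) := by
    rw [Int.floor_eq_iff]
    push_cast
    rw [le_div_iff₀ hq', div_lt_iff₀ hq']
    constructor <;> nlinarith
  have hdvd : q ∣ M / n ↔ r = 0 := by rw [← ht, hr, Nat.dvd_iff_mod_eq_zero]
  rw [← sub_div]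
  by_cases h0 : r = 0
  · have hf' : ⌊(v - 1) / q⌋ = (s : ℤ) - 1 := by
      rw [Int.floor_eq_iff]
      push_cast
      rw [le_div_iff₀ hq', div_lt_iff₀ hq']
      rw [h0] at htsr'
      have hq1 : (1 : ℝ) ≤ q := by exact_mod_cast hq
      push_cast at htsr'
      constructor <;> nlinarith
    rw [if_pos (hdvd.2 h0), sawtooth, sawtooth, Int.fract, Int.fract, hf, hf']
    push_cast
    ring
  · have hf' : ⌊(v - 1) / q⌋ = (s : ℤ) := by
      rw [Int.floor_eq_iff]
      push_cast
      rw [le_div_iff₀ hq', div_lt_iff₀ hq']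
      have hr1 : (1 : ℝ) ≤ r := by exact_mod_cast Nat.one_le_iff_ne_zero.2 h0
      constructor <;> nlinarith
    rw [if_neg (mt hdvd.1 h0), sawtooth, sawtooth, Int.fract, Int.fract, hf, hf']
    ring

lemma sum_range_ite_dvd (G : ℕ → ℝ) (q J : ℕ) :
    ∑ m ∈ range J, (if q ∣ m + 1 then G (m + 1) else 0) =
      ∑ k ∈ range (J / q), G ((k + 1) * q) := by
  induction J with
  | zero => simp
  | succ J ih =>
    rw [sum_range_succ, ih, Nat.succ_div]
    split_ifs with h
    · have h1 : (J / q + 1) * q = J + 1 := by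
        have h2 : (J + 1) / q = J / q + 1 := by rw [Nat.succ_div, if_pos h]
        rw [← h2, Nat.div_mul_cancel h]
      rw [sum_range_succ, h1]
    · simp

/-- Grouping the terms of a floor sum with large index by the value of the floor. -/
lemma sum_range_div_eq (F : ℕ → ℝ) (M J : ℕ) :
    ∑ n ∈ range M, F (M / (n + 1)) = ∑ n ∈ range (M / (J + 1)), F (M / (n + 1)) +
      ∑ m ∈ range J, F (m + 1) * (((M / (m + 1) : ℕ) : ℝ) - ((M / (m + 1 + 1) : ℕ) : ℝ)) := by
  induction J with
  | zero => simp
  | succ J ih =>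
    rw [ih, sum_range_succ]
    have hle : M / (J + 1 + 1) ≤ M / (J + 1) := Nat.div_le_div_left (by omega) (by omega)
    have h1 : ∑ n ∈ range (M / (J + 1)), F (M / (n + 1)) =
        ∑ n ∈ range (M / (J + 1 + 1)), F (M / (n + 1)) +
          F (J + 1) * (((M / (J + 1) : ℕ) : ℝ) - ((M / (J + 1 + 1) : ℕ) : ℝ)) := by
      rw [← sum_range_add_sum_Ico _ hle]
      congr 1
      rw [sum_congr rfl (g := fun _ => F (J + 1)), sum_const, Nat.card_Ico, nsmul_eq_mul,
        Nat.cast_sub hle, mul_comm]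
      intro n hn
      rw [mem_Ico] at hn
      congr 1
      have h2 := (Nat.le_div_iff_mul_le (by omega)).1 (show n + 1 ≤ M / (J + 1) by omega)
      have h3 := (Nat.div_lt_iff_lt_mul (by omega)).1 (show M / (J + 1 + 1) < n + 1 by omega)
      exact Nat.div_eq_of_lt_le (by linarith) (by linarith)
    rw [h1]
    ring

lemma abs_div_sub_tail_sum_le {M q K : ℕ} (hq : 0 < q) (hK : 0 < K) (hKY : K ≤ M / q)
    (hMK : (M : ℝ) / q ≤ 4 * K ^ 2) :
    |((M / (K * q + 1) : ℕ) : ℝ) / q - ∑ k ∈ Ico K (M / q),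
      (M : ℝ) / ((((k + 1) * q : ℕ) : ℝ) * (((k + 1) * q : ℕ) + 1))| ≤ 5 := by
  have hq1 : (1 : ℝ) ≤ q := by exact_mod_cast hq
  have hK1 : (1 : ℝ) ≤ K := by exact_mod_cast hK
  have hM0 : (0 : ℝ) ≤ M := Nat.cast_nonneg M
  set H : ℕ → ℝ := fun j => M / (j * q + 1) / q with hH
  have hH0 : ∀ j, 0 ≤ H j := fun j => by simp only [hH]; positivity
  have hsub : ∀ j : ℕ, H j - H (j + 1) = M / ((j * q + 1) * ((j + 1) * q + 1)) := by
    intro j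
    simp only [hH]
    push_cast
    field_simp
    ring
  set Y := M / q with hY
  have hup : ∑ k ∈ Ico K Y, (M : ℝ) / ((((k + 1) * q : ℕ) : ℝ) * (((k + 1) * q : ℕ) + 1)) ≤
      H K - H Y := by
    rw [← neg_sub (H Y), ← sum_Ico_sub H hKY, ← sum_neg_distrib]
    refine sum_le_sum fun k _ => ?_
    rw [neg_sub, hsub]
    push_cast
    gcongr
    nlinarith
  have hlow : H (K + 1) - H (Y + 1) ≤
      ∑ k ∈ Ico K Y, (M : ℝ) / ((((k + 1) * q : ℕ) : ℝ) * (((k + 1) * q : ℕ) + 1)) := by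
    rw [← neg_sub (H (Y + 1)), ← sum_Ico_sub (fun j => H (j + 1)) hKY, ← sum_neg_distrib]
    refine sum_le_sum fun k _ => ?_
    rw [neg_sub, hsub]
    have hk := Nat.cast_nonneg (α := ℝ) k
    push_cast
    rw [mul_comm (((k : ℝ) + 1) * q)]
    gcongr
    nlinarith
  have hN0 : ((M / (K * q + 1) : ℕ) : ℝ) / q ≤ H K := by
    simp only [hH]
    gcongr
    refine Nat.cast_div_le.trans (le_of_eq ?_)
    push_cast
    ring
  have hN1 : H K - 1 ≤ ((M / (K * q + 1) : ℕ) : ℝ) / q := by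
    have h1 : (M : ℝ) / (K * q + 1) ≤ ((M / (K * q + 1) : ℕ) : ℝ) + 1 := by
      rw [div_le_iff₀ (by positivity)]
      exact_mod_cast ((Nat.div_lt_iff_lt_mul (by omega)).1 (Nat.lt_add_one (M / (K * q + 1)))).le
    simp only [hH]
    rw [sub_le_iff_le_add]
    calc (M : ℝ) / (K * q + 1) / q ≤ (((M / (K * q + 1) : ℕ) : ℝ) + 1) / q := by gcongr
      _ ≤ _ := by
        rw [add_div]
        gcongr
        rw [div_le_one (by positivity)]
        exact hq1
  have hHY : H (Y + 1) ≤ 1 := by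
    simp only [hH]
    rw [div_div, div_le_one (by positivity)]
    have h1 : (M : ℝ) ≤ (Y + 1) * q := by
      exact_mod_cast ((Nat.div_lt_iff_lt_mul hq).1 (Nat.lt_add_one (M / q))).le
    push_cast
    nlinarith
  have hHK : H K - H (K + 1) ≤ 4 := by
    rw [hsub, div_le_iff₀ (by positivity)]
    rw [div_le_iff₀ (by positivity)] at hMK
    have h1 : (K : ℝ) * q * (K * q) ≤ (K * q + 1) * ((K + 1) * q + 1) := by
      gcongr <;> nlinarith
    have h2 : 4 * (K : ℝ) ^ 2 * q ≤ 4 * (K * q * (K * q)) := by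
      have : 0 ≤ (K : ℝ) ^ 2 * q := by positivity
      nlinarith
    linarith
  rw [abs_le]
  constructor <;> linarith [hH0 Y]

lemma exists_abs_count_dvd_sub_le :
    ∃ A : ℝ, 0 ≤ A ∧ ∀ M q : ℕ, 1 ≤ q → q ≤ M →
      |∑ n ∈ range M, (if q ∣ M / (n + 1) then 1 else 0 : ℝ) -
        M * ∑ m ∈ range M, (if q ∣ m + 1 then 1 / (((m + 1 : ℕ) : ℝ) * ((m + 1 : ℕ) + 1)) else 0)| ≤
      A * ((M : ℝ) / q) ^ (1 / 3 : ℝ) * (1 + Real.log (M / q)) := by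
  obtain ⟨A, hA, hsaw⟩ := exists_abs_sum_sawtooth_le
  refine ⟨4 * A + 5, by positivity, ?_⟩
  intro M q hq hqM
  have hq1 : (1 : ℝ) ≤ q := by exact_mod_cast hq
  have hq0 : (0 : ℝ) < q := by linarith
  set y : ℝ := (M : ℝ) / q with hy
  have hy1 : 1 ≤ y := by
    rw [hy, one_le_div hq0]
    exact_mod_cast hqM
  obtain ⟨K, hKdef⟩ : ∃ K, K = Nat.sqrt (M / q) := ⟨_, rfl⟩
  have hMq : 1 ≤ M / q := Nat.div_pos hqM hq
  have hK1 : 1 ≤ K := by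
    rw [hKdef, Nat.le_sqrt]
    omega
  have hK1' : (1 : ℝ) ≤ K := by exact_mod_cast hK1
  have hKY : K ≤ M / q := hKdef ▸ Nat.sqrt_le_self _
  have hKy : (K : ℝ) ≤ √y := by
    apply Real.le_sqrt_of_sq_le
    have h1 : ((K * K : ℕ) : ℝ) ≤ ((M / q : ℕ) : ℝ) := by
      exact_mod_cast hKdef ▸ Nat.sqrt_le (M / q)
    rw [pow_two]
    push_cast at h1
    exact h1.trans Nat.cast_div_le
  have hyK : √y ≤ 2 * K := by
    have h1 : √y ≤ K + 1 := by
      rw [Real.sqrt_le_iff]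
      refine ⟨by positivity, ?_⟩
      rw [hy, div_le_iff₀ hq0]
      have h2 : M / q < (K + 1) * (K + 1) := hKdef ▸ Nat.lt_succ_sqrt _
      have h3 : M < (K + 1) * (K + 1) * q := (Nat.div_lt_iff_lt_mul hq).1 h2
      rw [pow_two]
      exact_mod_cast h3.le
    linarith
  have hyK2 : y ≤ 4 * K ^ 2 := by
    rw [Real.sqrt_le_iff] at hyK
    linarith [hyK.2]
  obtain ⟨N, hN⟩ : ∃ N, N = M / (K * q + 1) := ⟨_, rfl⟩
  have hNy : (N : ℝ) ≤ 2 * √y := by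
    have h1 : (N : ℝ) ≤ y / K := by
      rw [hN, hy, div_div]
      refine Nat.cast_div_le.trans ?_
      push_cast
      gcongr
      nlinarith
    refine h1.trans ?_
    rw [div_le_iff₀ (by positivity)]
    nlinarith [Real.mul_self_sqrt (show 0 ≤ y by linarith), Real.sqrt_nonneg y]
  have htail := abs_div_sub_tail_sum_le hq hK1 hKY hyK2
  rw [← hN] at htail
  have hcount := sum_range_div_eq (fun t => if q ∣ t then 1 else 0) M (K * q)
  rw [← hN] at hcount
  have hfirst : ∑ n ∈ range N, (if q ∣ M / (n + 1) then 1 else 0 : ℝ) = N / q +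
      ∑ n ∈ range N, sawtooth (y / ((n : ℝ) + 1 + 0) + -(1 / q)) -
      ∑ n ∈ range N, sawtooth (y / ((n : ℝ) + 1 + 0) + 0) := by
    have h1 : (N : ℝ) / q = ∑ n ∈ range N, (1 / q : ℝ) := by
      rw [sum_const, card_range, nsmul_eq_mul, mul_one_div]
    rw [h1, ← sum_add_distrib, ← sum_sub_distrib]
    refine sum_congr rfl fun n _ => ?_
    rw [ite_dvd_div_eq_sawtooth n.succ_pos hq, add_zero, add_zero, ← sub_eq_add_neg]
    push_cast
    rfl
  have hsecond : ∑ m ∈ range (K * q), (if q ∣ m + 1 then 1 else 0 : ℝ) *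
        (((M / (m + 1) : ℕ) : ℝ) - ((M / (m + 1 + 1) : ℕ) : ℝ)) =
      ∑ k ∈ range K, (M : ℝ) / ((((k + 1) * q : ℕ) : ℝ) * (((k + 1) * q : ℕ) + 1)) -
      ∑ k ∈ range K, sawtooth (y / ((k : ℝ) + 1 + 0) + 0) +
      ∑ k ∈ range K, sawtooth (y / ((k : ℝ) + 1 + 1 / q) + 0) := by
    simp only [ite_mul, one_mul, zero_mul]
    rw [sum_range_ite_dvd (fun t => ((M / t : ℕ) : ℝ) - ((M / (t + 1) : ℕ) : ℝ)),
      Nat.mul_div_cancel _ hq, ← sum_sub_distrib, ← sum_add_distrib]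
    refine sum_congr rfl fun k _ => ?_
    have h1 : (M : ℝ) / ((k + 1) * q : ℕ) = y / ((k : ℝ) + 1 + 0) + 0 := by
      rw [hy]
      push_cast
      field_simp
      ring
    have h2 : (M : ℝ) / ((k + 1) * q + 1 : ℕ) = y / ((k : ℝ) + 1 + 1 / q) + 0 := by
      rw [hy]
      push_cast
      field_simp
      ring
    rw [natCast_div_eq_sub_sawtooth, natCast_div_eq_sub_sawtooth, ← h1, ← h2]
    have h3 : (M : ℝ) / ((((k + 1) * q : ℕ) : ℝ) * (((k + 1) * q : ℕ) + 1)) =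
        (M : ℝ) / ((k + 1) * q : ℕ) - (M : ℝ) / ((k + 1) * q + 1 : ℕ) := by
      push_cast
      field_simp
      ring
    rw [h3]
    ring
  have hmain : M * ∑ m ∈ range M,
        (if q ∣ m + 1 then 1 / (((m + 1 : ℕ) : ℝ) * ((m + 1 : ℕ) + 1)) else 0) =
      ∑ k ∈ range K, (M : ℝ) / ((((k + 1) * q : ℕ) : ℝ) * (((k + 1) * q : ℕ) + 1)) +
      ∑ k ∈ Ico K (M / q), (M : ℝ) / ((((k + 1) * q : ℕ) : ℝ) * (((k + 1) * q : ℕ) + 1)) := by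
    rw [sum_range_ite_dvd (fun t => 1 / ((t : ℝ) * (t + 1))), sum_range_add_sum_Ico _ hKY, mul_sum]
    exact sum_congr rfl fun k _ => by rw [mul_one_div]
  have hinv : (1 : ℝ) / q ≤ 1 := by
    rw [div_le_one hq0]
    exact hq1
  have e1 := abs_le.1 (hsaw y 0 (-(1 / q)) N hy1 le_rfl zero_le_one hNy)
  have e2 := abs_le.1 (hsaw y 0 0 N hy1 le_rfl zero_le_one hNy)
  have e3 := abs_le.1 (hsaw y 0 0 K hy1 le_rfl zero_le_one (by linarith [Real.sqrt_nonneg y]))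
  have e4 := abs_le.1 (hsaw y (1 / q) 0 K hy1 (by positivity) hinv
    (by linarith [Real.sqrt_nonneg y]))
  have e5 := abs_le.1 htail
  have hone : 1 ≤ y ^ (1 / 3 : ℝ) * (1 + Real.log y) := by
    have h1 : 1 ≤ y ^ (1 / 3 : ℝ) := Real.one_le_rpow hy1 (by norm_num)
    have h2 := Real.log_nonneg hy1
    nlinarith
  rw [hcount, hfirst, hsecond, hmain, abs_le]
  constructor <;> linarith [e1.1, e1.2, e2.1, e2.2, e3.1, e3.2, e4.1, e4.2, e5.1, e5.2]

lemma muk_mem_unitInterval (k n : ℕ) : 0 ≤ muk k n ∧ muk k n ≤ 1 := by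
  rw [muk]
  split_ifs <;> norm_num

lemma exists_pow_three_dvd_iff_dvd {m : ℕ} (hm : 0 < m) :
    ∃ b : ℕ, 0 < b ∧ ∀ d : ℕ, d ^ 3 ∣ m ↔ d ∣ b := by
  have hle : ∀ d : ℕ, d ^ 3 ∣ m → d ≤ m := fun d hd =>
    (Nat.le_self_pow three_ne_zero d).trans (Nat.le_of_dvd hm hd)
  obtain ⟨b, hb⟩ : ∃ b, b = Nat.findGreatest (fun b => b ^ 3 ∣ m) m := ⟨_, rfl⟩
  have hb1 : 1 ≤ b := hb ▸ Nat.le_findGreatest hm (by simp)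
  have hbm : b ^ 3 ∣ m :=
    hb ▸ Nat.findGreatest_spec (P := fun b => b ^ 3 ∣ m) (m := 1) hm (by simp)
  refine ⟨b, hb1, fun d => ⟨fun hd => ?_, fun hd => (pow_dvd_pow_of_dvd hd 3).trans hbm⟩⟩
  have h1 : (Nat.lcm d b) ^ 3 ∣ m := by
    rw [← Nat.pow_lcm_pow]
    exact Nat.lcm_dvd hd hbm
  have h2 : Nat.lcm d b ≤ b := by
    have := Nat.le_findGreatest (P := fun b => b ^ 3 ∣ m) (hle _ h1) h1
    rwa [← hb] at this
  have h3 : Nat.lcm d b = b := le_antisymm h2 <| Nat.le_of_dvd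
    (Nat.pos_of_dvd_of_pos ((dvd_pow_self _ three_ne_zero).trans h1) hm) (Nat.dvd_lcm_right d b)
  rw [← h3]
  exact Nat.dvd_lcm_left d b

lemma muk_three_eq_sum_moebius {m D : ℕ} (hm : 0 < m) (hD : m < (D + 1) ^ 3) :
    muk 3 m = ∑ d ∈ range D,
      (ArithmeticFunction.moebius (d + 1) : ℝ) * (if (d + 1) ^ 3 ∣ m then 1 else 0) := by
  obtain ⟨b, hb0, hb⟩ := exists_pow_three_dvd_iff_dvd hm
  have hmuk : muk 3 m = if b = 1 then 1 else 0 := by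
    have hiff : (∀ p : ℕ, p.Prime → ¬ p ^ 3 ∣ m) ↔ b = 1 := by
      refine ⟨fun h => ?_, fun h p hp hpm => ?_⟩
      · by_contra hne
        obtain ⟨p, hp, hpb⟩ := Nat.exists_prime_and_dvd hne
        exact h p hp ((hb p).2 hpb)
      · rw [hb, h, Nat.dvd_one] at hpm
        exact hp.one_lt.ne' hpm
    by_cases h : b = 1
    · rw [muk, if_pos (hiff.2 h), if_pos h]
    · rw [muk, if_neg (mt hiff.1 h), if_neg h]
  have hsum : (∑ d ∈ b.divisors, ArithmeticFunction.moebius d : ℤ) = if b = 1 then 1 else 0 := by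
    rw [← ArithmeticFunction.coe_mul_zeta_apply, ArithmeticFunction.moebius_mul_coe_zeta,
      ArithmeticFunction.one_apply]
  have hsum' : (∑ d ∈ b.divisors, (ArithmeticFunction.moebius d : ℝ)) =
      if b = 1 then 1 else 0 := by
    exact_mod_cast congrArg (Int.cast : ℤ → ℝ) hsum
  rw [hmuk, ← hsum']
  simp only [mul_ite, mul_one, mul_zero]
  rw [← sum_filter]
  refine sum_nbij' (· - 1) (· + 1) ?_ ?_ ?_ ?_ ?_
  · intro d hd
    have hd0 := Nat.pos_of_mem_divisors hd
    have hdm := (hb d).2 (Nat.dvd_of_mem_divisors hd)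
    have h1 : d < D + 1 := lt_of_pow_lt_pow_left₀ 3 (by omega) ((Nat.le_of_dvd hm hdm).trans_lt hD)
    rw [mem_filter, mem_range, Nat.sub_add_cancel hd0]
    exact ⟨by omega, hdm⟩
  · intro d hd
    rw [Nat.mem_divisors]
    exact ⟨(hb _).1 (mem_filter.1 hd).2, hb0.ne'⟩
  · intro d hd
    exact Nat.sub_add_cancel (Nat.pos_of_mem_divisors hd)
  · intro d _
    exact Nat.add_sub_cancel _ _
  · intro d hd
    rw [Nat.sub_add_cancel (Nat.pos_of_mem_divisors hd)]

lemma exists_cube_le_lt (M : ℕ) : ∃ D : ℕ, D ^ 3 ≤ M ∧ M < (D + 1) ^ 3 := by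
  have h : ∃ D : ℕ, M < (D + 1) ^ 3 :=
    ⟨M, (Nat.lt_succ_self M).trans_le (Nat.le_self_pow three_ne_zero _)⟩
  refine ⟨Nat.find h, ?_, Nat.find_spec h⟩
  rcases Nat.eq_zero_or_pos (Nat.find h) with h0 | h0
  · rw [h0]
    simp
  · have h1 := Nat.find_min h (Nat.sub_lt h0 one_pos)
    rw [Nat.sub_add_cancel (show 1 ≤ Nat.find h from h0)] at h1
    exact not_lt.1 h1

lemma exists_abs_sum_muk_sub_partial_le :
    ∃ A : ℝ, 0 ≤ A ∧ ∀ M : ℕ, 1 ≤ M →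
      |∑ n ∈ range M, muk 3 (M / (n + 1)) -
        M * ∑ m ∈ range M, muk 3 (m + 1) / (((m : ℝ) + 1) * ((m : ℝ) + 2))| ≤
      A * (M : ℝ) ^ (1 / 3 : ℝ) * (1 + Real.log M) ^ 2 := by
  obtain ⟨A, hA, hcount⟩ := exists_abs_count_dvd_sub_le
  refine ⟨A, hA, fun M hM => ?_⟩
  have hM1 : (1 : ℝ) ≤ M := by exact_mod_cast hM
  obtain ⟨D, hD, hD'⟩ := exists_cube_le_lt M
  have h1 : ∑ n ∈ range M, muk 3 (M / (n + 1)) = ∑ d ∈ range D,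
      (ArithmeticFunction.moebius (d + 1) : ℝ) *
        ∑ n ∈ range M, (if (d + 1) ^ 3 ∣ M / (n + 1) then 1 else 0 : ℝ) := by
    simp only [mul_sum]
    rw [sum_comm]
    refine sum_congr rfl fun n hn => muk_three_eq_sum_moebius ?_ ?_
    · exact Nat.div_pos (mem_range.1 hn) n.succ_pos
    · exact (Nat.div_le_self _ _).trans_lt hD'
  have h2 : ∑ m ∈ range M, muk 3 (m + 1) / (((m : ℝ) + 1) * ((m : ℝ) + 2)) = ∑ d ∈ range D,
      (ArithmeticFunction.moebius (d + 1) : ℝ) * ∑ m ∈ range M,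
        (if (d + 1) ^ 3 ∣ m + 1 then 1 / (((m + 1 : ℕ) : ℝ) * ((m + 1 : ℕ) + 1)) else 0) := by
    simp only [mul_sum]
    rw [sum_comm]
    refine sum_congr rfl fun m hm => ?_
    rw [muk_three_eq_sum_moebius m.succ_pos
      (lt_of_le_of_lt (show m + 1 ≤ M from mem_range.1 hm) hD'), sum_div]
    refine sum_congr rfl fun d _ => ?_
    rw [mul_div_assoc]
    split_ifs
    · push_cast
      congr 3
      ring
    · simp
  have hlog : 0 ≤ Real.log M := Real.log_nonneg hM1
  have h3 : ∀ d ∈ range D, |(ArithmeticFunction.moebius (d + 1) : ℝ) *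
      (∑ n ∈ range M, (if (d + 1) ^ 3 ∣ M / (n + 1) then 1 else 0 : ℝ) -
        M * ∑ m ∈ range M,
          (if (d + 1) ^ 3 ∣ m + 1 then 1 / (((m + 1 : ℕ) : ℝ) * ((m + 1 : ℕ) + 1)) else 0))| ≤
      A * (M : ℝ) ^ (1 / 3 : ℝ) * (1 + Real.log M) * ((d + 1 : ℕ) : ℝ)⁻¹ := by
    intro d hd
    have hdD : d + 1 ≤ D := mem_range.1 hd
    have hq : 1 ≤ (d + 1) ^ 3 := Nat.one_le_pow _ _ d.succ_pos
    have hqM : (d + 1) ^ 3 ≤ M := (Nat.pow_le_pow_left hdD 3).trans hD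
    have hmu : |(ArithmeticFunction.moebius (d + 1) : ℝ)| ≤ 1 := by
      exact_mod_cast ArithmeticFunction.abs_moebius_le_one (n := d + 1)
    rw [abs_mul]
    refine (mul_le_of_le_one_left (abs_nonneg _) hmu).trans ((hcount M _ hq hqM).trans ?_)
    have hd0 : (0 : ℝ) < ((d + 1 : ℕ) : ℝ) := by positivity
    have h4 : ((M : ℝ) / ((d + 1) ^ 3 : ℕ)) ^ (1 / 3 : ℝ) =
        (M : ℝ) ^ (1 / 3 : ℝ) * ((d + 1 : ℕ) : ℝ)⁻¹ := by
      rw [Nat.cast_pow, Real.div_rpow (by positivity) (by positivity), ← Real.rpow_natCast,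
        ← Real.rpow_mul hd0.le]
      norm_num
      rfl
    have hq1 : (1 : ℝ) ≤ ((d + 1) ^ 3 : ℕ) := by exact_mod_cast hq
    have h5 : Real.log ((M : ℝ) / ((d + 1) ^ 3 : ℕ)) ≤ Real.log M :=
      Real.log_le_log (by positivity) (div_le_self (by positivity) hq1)
    rw [h4]
    calc _ ≤ A * ((M : ℝ) ^ (1 / 3 : ℝ) * ((d + 1 : ℕ) : ℝ)⁻¹) * (1 + Real.log M) := by gcongr
      _ = _ := by ring
  have h6 : ∑ d ∈ range D, ((d + 1 : ℕ) : ℝ)⁻¹ ≤ 1 + Real.log M := by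
    have h7 := harmonic_le_one_add_log D
    rw [harmonic] at h7
    push_cast at h7 ⊢
    refine h7.trans ?_
    rcases Nat.eq_zero_or_pos D with h0 | h0
    · rw [h0]
      simpa using hlog
    · have hDM : D ≤ M := (Nat.le_self_pow three_ne_zero D).trans hD
      have h8 : (0 : ℝ) < D := by exact_mod_cast h0
      gcongr
  rw [h1, h2, mul_sum, ← sum_sub_distrib]
  refine (abs_sum_le_sum_abs _ _).trans ?_
  refine (sum_le_sum fun d hd => ?_).trans
    (b := ∑ d ∈ range D, A * (M : ℝ) ^ (1 / 3 : ℝ) * (1 + Real.log M) * ((d + 1 : ℕ) : ℝ)⁻¹) ?_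
  · rw [mul_left_comm (M : ℝ), ← mul_sub]
    exact h3 d hd
  · rw [← mul_sum, pow_two, ← mul_assoc]
    gcongr

lemma tsum_muk_bounds (k M : ℕ) :
    ∑ m ∈ range M, muk k (m + 1) / (((m : ℝ) + 1) * ((m : ℝ) + 2)) ≤
        ∑' m : ℕ, muk k (m + 1) / (((m : ℝ) + 1) * ((m : ℝ) + 2)) ∧
      ∑' m : ℕ, muk k (m + 1) / (((m : ℝ) + 1) * ((m : ℝ) + 2)) ≤
        ∑ m ∈ range M, muk k (m + 1) / (((m : ℝ) + 1) * ((m : ℝ) + 2)) + 1 / ((M : ℝ) + 1) := by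
  set c : ℕ → ℝ := fun m => muk k (m + 1) / (((m : ℝ) + 1) * ((m : ℝ) + 2)) with hc
  have hc0 : ∀ m, 0 ≤ c m := fun m => div_nonneg (muk_mem_unitInterval _ _).1 (by positivity)
  have hstep : ∀ M H : ℕ, ∑ m ∈ range (M + H), c m + 1 / (((M + H : ℕ) : ℝ) + 1) ≤
      ∑ m ∈ range M, c m + 1 / ((M : ℝ) + 1) := by
    intro M H
    induction H with
    | zero => exact le_rfl
    | succ H ih =>
      refine le_trans ?_ ih
      rw [← add_assoc, sum_range_succ]
      set j := M + H
      have h1 : c j ≤ 1 / ((j : ℝ) + 1) - 1 / (((j + 1 : ℕ) : ℝ) + 1) := by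
        have h2 : 1 / ((j : ℝ) + 1) - 1 / (((j + 1 : ℕ) : ℝ) + 1) =
            1 / (((j : ℝ) + 1) * ((j : ℝ) + 2)) := by
          push_cast
          field_simp
          ring
        rw [h2]
        simp only [hc]
        gcongr
        exact (muk_mem_unitInterval _ _).2
      linarith
  have hbound : ∀ M H : ℕ, ∑ m ∈ range H, c m ≤ ∑ m ∈ range M, c m + 1 / ((M : ℝ) + 1) := by
    intro M H
    have h1 : ∑ m ∈ range H, c m ≤ ∑ m ∈ range (M + H), c m :=
      sum_le_sum_of_subset_of_nonneg (range_subset_range.2 (by omega)) fun m _ _ => hc0 m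
    have h2 : 0 ≤ 1 / (((M + H : ℕ) : ℝ) + 1) := by positivity
    linarith [hstep M H]
  have hs : Summable c := summable_of_sum_range_le hc0 (hbound 0)
  exact ⟨hs.sum_le_tsum _ fun m _ => hc0 m, Real.tsum_le_of_sum_range_le hc0 (hbound M)⟩

/-- With `μ₃` the indicator of cubefree numbers,
`∑_{n ≤ x} μ₃(⌊x/n⌋) = C x + O(x^{1/3} (log x)²)` as `x → ∞`, where
`C = ∑_{n=1}^∞ μ₃(n)/(n(n+1))`. -/
theorem cubefree_floor_sum_asymptotic :
    (fun x : ℝ => (∑ n ∈ Finset.Icc 1 ⌊x⌋₊, muk 3 ⌊x / (n : ℝ)⌋₊) -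
        (∑' n : ℕ, muk 3 (n + 1) / (((n : ℝ) + 1) * ((n : ℝ) + 2))) * x)
      =O[atTop] fun x : ℝ => x ^ ((1 : ℝ) / 3) * (Real.log x) ^ 2 := by
  obtain ⟨A, hA, hmain⟩ := exists_abs_sum_muk_sub_partial_le
  refine IsBigO.of_bound (4 * A + 2) ?_
  filter_upwards [eventually_ge_atTop (Real.exp 1)] with x hx
  have hx1 : 1 ≤ x := (Real.one_le_exp zero_le_one).trans hx
  have hx0 : 0 < x := by linarith
  have hlog : 1 ≤ Real.log x := by rwa [Real.le_log_iff_exp_le hx0]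
  have hsum : ∑ n ∈ Finset.Icc 1 ⌊x⌋₊, muk 3 ⌊x / (n : ℝ)⌋₊ =
      ∑ n ∈ range ⌊x⌋₊, muk 3 (⌊x⌋₊ / (n + 1)) := by
    refine sum_nbij' (· - 1) (· + 1) ?_ ?_ ?_ ?_ ?_
    · intro n hn
      rw [mem_Icc] at hn
      rw [mem_range]
      omega
    · intro n hn
      rw [mem_range] at hn
      rw [mem_Icc]
      omega
    · intro n hn
      exact Nat.sub_add_cancel (mem_Icc.1 hn).1
    · intro n _
      exact Nat.add_sub_cancel _ _
    · intro n hn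
      rw [Nat.sub_add_cancel (mem_Icc.1 hn).1, Nat.floor_div_natCast]
  rw [hsum]
  have hM : 1 ≤ ⌊x⌋₊ := Nat.le_floor (by exact_mod_cast hx1)
  have hMx : (⌊x⌋₊ : ℝ) ≤ x := Nat.floor_le hx0.le
  have hxM : x < ⌊x⌋₊ + 1 := Nat.lt_floor_add_one x
  set M := ⌊x⌋₊
  have hM1 : (1 : ℝ) ≤ M := by exact_mod_cast hM
  have hm := hmain M hM
  obtain ⟨t1, t2⟩ := tsum_muk_bounds 3 M
  obtain ⟨t3, t4⟩ := tsum_muk_bounds 3 0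
  rw [sum_range_zero] at t3 t4
  norm_num at t4
  set C := ∑' n : ℕ, muk 3 (n + 1) / (((n : ℝ) + 1) * ((n : ℝ) + 2))
  set P := ∑ m ∈ range M, muk 3 (m + 1) / (((m : ℝ) + 1) * ((m : ℝ) + 2))
  set S := ∑ n ∈ range M, muk 3 (M / (n + 1))
  set w := x ^ ((1 : ℝ) / 3)
  have hw1 : 1 ≤ w := Real.one_le_rpow hx1 (by norm_num)
  have hlogM : Real.log M ≤ Real.log x := Real.log_le_log (by linarith) hMx
  have hlogM0 : 0 ≤ Real.log M := Real.log_nonneg hM1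
  have h1 : |S - M * P| ≤ 4 * A * (w * Real.log x ^ 2) := by
    refine hm.trans ?_
    have hMw : (M : ℝ) ^ ((1 : ℝ) / 3) ≤ w := Real.rpow_le_rpow (by positivity) hMx (by norm_num)
    calc _ ≤ A * w * (Real.log x + Real.log x) ^ 2 := by gcongr
      _ = _ := by ring
  have h2 : (1 : ℝ) ≤ w * Real.log x ^ 2 := one_le_mul_of_one_le_of_one_le hw1 (one_le_pow₀ hlog)
  have h3 : M * (C - P) ≤ 1 := by
    have h4 : M * (C - P) ≤ M * (1 / ((M : ℝ) + 1)) := by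
      gcongr
      linarith
    refine h4.trans ?_
    rw [mul_one_div, div_le_one (by positivity)]
    linarith
  have h5 : 0 ≤ M * (C - P) := mul_nonneg (by positivity) (by linarith)
  have h6 : 0 ≤ C * (x - M) := mul_nonneg t3 (by linarith)
  have h7 : C * (x - M) ≤ 1 := mul_le_one₀ t4 (by linarith) (by linarith)
  rw [Real.norm_eq_abs, Real.norm_of_nonneg (by positivity)]
  have h8 := abs_le.1 h1
  rw [abs_le]
  constructor <;> nlinarith [h8.1, h8.2]
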